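/- Let A be a finite-dimensional algebra over a field k. Then the dimension of the bounded derived category of finitely generated A-modules is strictly smaller than the Loewy length of A: dim D^b(mod A) < LL(A), where LL(A) is the least integer d ≥ 1 with J(A)^d = 0. -/

import Mathlib

/-!
Dimension of triangulated categories (Rouquier): the bounded derived category of
finitely generated modules over a finitely generated commutative algebra over a
perfect field has finite dimension.
-/

open CategoryTheory CategoryTheory.Limits CategoryTheory.Pretriangulated

section TriangulatedDimension

variable (C : Type*) [Category C] [HasZeroObject C] [Preadditive C] [HasShift C ℤ]
  [∀ n : ℤ, (shiftFunctor C n).Additive] [Pretriangulated C]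

/-- `X` is a direct summand (retract) of `Z`. -/
def IsRetract (X Z : C) : Prop := ∃ (s : X ⟶ Z) (r : Z ⟶ X), s ≫ r = 𝟙 X

/-- `I₁ * I₂` : the smallest class of objects, closed under direct summands, containing
every object `Z` fitting in a distinguished triangle `X₁ → Z → X₂ → X₁[1]` with
`X₁ ∈ I₁` and `X₂ ∈ I₂`. -/
def starSets (I₁ I₂ : Set C) : Set C :=
  {X | ∃ (X₁ Z X₂ : C) (f : X₁ ⟶ Z) (g : Z ⟶ X₂) (h : X₂ ⟶ X₁⟦(1 : ℤ)⟧),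
    Triangle.mk f g h ∈ (distTriang C) ∧ X₁ ∈ I₁ ∧ X₂ ∈ I₂ ∧ IsRetract C X Z}

/-- `⟨M⟩` : the smallest class of objects of `C` containing `M` and closed under finite
direct sums, direct summands and shifts in both directions. -/
inductive gen (M : C) : C → Prop
  | base : gen M M
  | sum {X Y Z : C} (i : X ⟶ Z) (p : Z ⟶ X) (j : Y ⟶ Z) (q : Z ⟶ Y) :
      gen M X → gen M Y → i ≫ p = 𝟙 X → j ≫ q = 𝟙 Y → i ≫ q = 0 → j ≫ p = 0 →
      p ≫ i + q ≫ j = 𝟙 Z → gen M Z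
  | shift {X : C} (n : ℤ) : gen M X → gen M (X⟦n⟧)
  | retract {X Z : C} : gen M Z → IsRetract C X Z → gen M X

/-- The classes `⟨M⟩ᵢ` : `⟨M⟩₀ = {0}` and `⟨M⟩ᵢ₊₁ = ⟨M⟩ᵢ * ⟨M⟩`. -/
def level (M : C) : ℕ → Set C
  | 0 => {X | IsZero X}
  | i + 1 => starSets C (level M i) {X | gen C M X}

/-- `dimLE S d` : the (triangulated) subcategory with class of objects `S` has dimension
at most `d`, i.e. there is an object `M` of `S` with `⟨M⟩_{d+1} = S`. -/
def dimLE (S : Set C) (d : ℕ) : Prop := ∃ M ∈ S, level C M (d + 1) = S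

/-- The dimension of the (triangulated) subcategory with class of objects `S`, as an
element of `ℕ∞` : the least `d` such that some object generates `S` in `d + 1` steps,
and `∞` if there is no such `d`. -/
noncomputable def trdim (S : Set C) : ℕ∞ := sInf ((↑) '' {d : ℕ | dimLE C S d})

end TriangulatedDimension

variable (A : Type) [Ring A]

noncomputable instance moduleCatHasDerivedCategory :
    HasDerivedCategory (ModuleCat.{0} A) :=
  HasDerivedCategory.standard _

/-- The class of objects of the bounded derived category `D^b(mod A)` of finitely
generated `A`-modules, realized inside the derived category of `A`-modules as the
complexes with bounded, finitely generated homology. -/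
def Db : Set (DerivedCategory (ModuleCat.{0} A)) :=
  {X | (∃ a b : ℤ, ∀ n : ℤ, n < a ∨ b < n →
      IsZero ((DerivedCategory.homologyFunctor (ModuleCat.{0} A) n).obj X)) ∧
    ∀ n : ℤ, Module.Finite A ((DerivedCategory.homologyFunctor (ModuleCat.{0} A) n).obj X)}

/-- The Loewy length of a ring `B`, as an element of `ℕ∞` : the least `d ≥ 1` such that
`J(B)^d = 0`, i.e. every product of `d` elements of the Jacobson radical vanishes. -/
noncomputable def loewyLength (B : Type) [Ring B] : ℕ∞ :=
  sInf ((↑) '' {d : ℕ | 1 ≤ d ∧ ∀ l : List B, l.length = d →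
    (∀ x ∈ l, x ∈ (⊥ : Ideal B).jacobson) → l.prod = 0})

namespace RouquierLoewy

section Abstract

set_option linter.unusedSectionVars false

variable {C : Type*} [Category C] [HasZeroObject C] [Preadditive C] [HasShift C ℤ]
  [∀ n : ℤ, (shiftFunctor C n).Additive] [Pretriangulated C]

lemma gen_of_iso {M X Y : C} (e : X ≅ Y) (h : gen C M Y) : gen C M X :=
  h.retract ⟨e.hom, e.inv, e.hom_inv_id⟩

lemma gen_of_isZero (M : C) {X : C} (h : IsZero X) : gen C M X :=
  gen.base.retract ⟨0, 0, h.eq_of_src _ _⟩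

lemma level_of_iso {M X Y : C} (e : X ≅ Y) {i : ℕ} (h : Y ∈ level C M i) : X ∈ level C M i := by
  cases i with
  | zero => exact IsZero.of_iso h e
  | succ i =>
    obtain ⟨X₁, Z, X₂, f, g, h, hT, h₁, h₂, s, r, hs⟩ := h
    exact ⟨X₁, Z, X₂, f, g, h, hT, h₁, h₂, e.hom ≫ s, r ≫ e.inv, by simp [reassoc_of% hs]⟩

lemma mem_level_succ {M : C} {i : ℕ} {T : Triangle C} (hT : T ∈ distTriang C)
    (h₁ : T.obj₁ ∈ level C M i) (h₃ : gen C M T.obj₃) : T.obj₂ ∈ level C M (i + 1) :=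
  ⟨_, _, _, _, _, _, hT, h₁, h₃, 𝟙 _, 𝟙 _, by simp⟩

/-- A class of objects containing `⟨M⟩ᵢ` for every `i` as soon as it contains `M` and is
closed under the operations defining these classes. -/
lemma level_subset {S : Set C} {M : C} (hM : M ∈ S)
    (hzero : ∀ X, IsZero X → X ∈ S)
    (hretract : ∀ X Z, Z ∈ S → IsRetract C X Z → X ∈ S)
    (hshift : ∀ X (n : ℤ), X ∈ S → X⟦n⟧ ∈ S)
    (hext : ∀ T ∈ distTriang C, T.obj₁ ∈ S → T.obj₃ ∈ S → T.obj₂ ∈ S) (i : ℕ) :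
    level C M i ⊆ S := by
  have hgen : ∀ X, gen C M X → X ∈ S := by
    intro X hX
    induction hX with
    | base => exact hM
    | @sum X Y Z i p j q _ _ hip hjq hiq hjp hZ hX hY =>
      refine hretract Z (X ⊞ Y) (hext _ (binaryBiproductTriangle_distinguished X Y) hX hY)
        ⟨biprod.lift p q, biprod.desc i j, ?_⟩
      simpa using hZ
    | shift n _ h => exact hshift _ _ h
    | retract _ h hZ => exact hretract _ _ hZ h
  induction i with
  | zero => exact hzero
  | succ i ih =>
    rintro X ⟨X₁, Z, X₂, f, g, h, hT, h₁, h₂, hX⟩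
    exact hretract _ _ (hext _ hT (ih h₁) (hgen _ h₂)) hX

end Abstract

section DbClosure

variable {A}

variable (A) in
/-- The derived category of the category of `A`-modules. -/
abbrev DMod := DerivedCategory (ModuleCat.{0} A)

variable (A) in
/-- The `n`-th homology functor on the derived category of the category of `A`-modules. -/
noncomputable abbrev homol (n : ℤ) : DMod A ⥤ ModuleCat.{0} A :=
  DerivedCategory.homologyFunctor (ModuleCat.{0} A) n

lemma mem_Db_of_isZero {X : DMod A} (hX : IsZero X) : X ∈ Db A := by
  have h : ∀ n, IsZero ((homol A n).obj X) := fun n => (homol A n).map_isZero hX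
  refine ⟨⟨0, 0, fun n _ => h n⟩, fun n => ?_⟩
  have := ModuleCat.subsingleton_of_isZero (h n)
  infer_instance

lemma isZero_of_retract {X Z : ModuleCat.{0} A} (s : X ⟶ Z) (r : Z ⟶ X) (h : s ≫ r = 𝟙 X)
    (hZ : IsZero Z) : IsZero X := by
  rw [IsZero.iff_id_eq_zero, ← h, hZ.eq_of_tgt s 0, zero_comp]

lemma finite_of_retract {X Z : ModuleCat.{0} A} (s : X ⟶ Z) (r : Z ⟶ X) (h : s ≫ r = 𝟙 X)
    [Module.Finite A Z] : Module.Finite A X :=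
  Module.Finite.of_surjective r.hom fun x => ⟨s x, by
    rw [← ModuleCat.comp_apply, h, ModuleCat.id_apply]⟩

lemma mem_Db_of_isRetract {X Z : DMod A} (hZ : Z ∈ Db A) (h : IsRetract (DMod A) X Z) :
    X ∈ Db A := by
  obtain ⟨s, r, h⟩ := h
  have h' : ∀ n, (homol A n).map s ≫ (homol A n).map r = 𝟙 _ := fun n => by
    rw [← Functor.map_comp, h, CategoryTheory.Functor.map_id]
  obtain ⟨⟨a, b, hab⟩, hf⟩ := hZ
  refine ⟨⟨a, b, fun n hn => isZero_of_retract _ _ (h' n) (hab n hn)⟩, fun n => ?_⟩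
  have := hf n
  exact finite_of_retract _ _ (h' n)

lemma mem_Db_shift {X : DMod A} (m : ℤ) (hX : X ∈ Db A) : X⟦m⟧ ∈ Db A := by
  have e : ∀ n : ℤ, (homol A n).obj (X⟦m⟧) ≅ (homol A (m + n)).obj X := fun n =>
    ((homol A 0).shiftIso m n (m + n) rfl).app X
  obtain ⟨⟨a, b, hab⟩, hf⟩ := hX
  refine ⟨⟨a - m, b - m, fun n hn => (hab (m + n) (by lia)).of_iso (e n)⟩, fun n => ?_⟩
  have := hf (m + n)
  exact finite_of_retract _ _ (e n).hom_inv_id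

lemma mem_Db_of_distTriang [IsNoetherianRing A] (T : Triangle (DMod A))
    (hT : T ∈ distTriang (DMod A))
    (h₁ : T.obj₁ ∈ Db A) (h₃ : T.obj₃ ∈ Db A) : T.obj₂ ∈ Db A := by
  obtain ⟨⟨a, b, hab⟩, hf⟩ := h₁
  obtain ⟨⟨a', b', hab'⟩, hf'⟩ := h₃
  have ex := fun n => (homol A n).map_distinguished_exact T hT
  refine ⟨⟨min a a', max b b', fun n hn => ?_⟩, fun n => ?_⟩
  · exact (ex n).isZero_of_both_zeros ((hab n (by lia)).eq_of_src _ _)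
      ((hab' n (by lia)).eq_of_tgt _ _)
  · have := hf n
    have := hf' n
    have h₁ : IsNoetherian A ((homol A n).obj T.obj₁) := inferInstance
    have h₃ : IsNoetherian A ((homol A n).obj T.obj₃) := inferInstance
    have h₂ : IsNoetherian A ((homol A n).obj T.obj₂) := isNoetherian_of_range_eq_ker
      ((homol A n).map T.mor₁).hom ((homol A n).map T.mor₂).hom ((ex n).moduleCat_range_eq_ker)
    exact inferInstanceAs (Module.Finite A ((homol A n).obj T.obj₂))

lemma level_subset_Db [IsNoetherianRing A] {M : DMod A} (hM : M ∈ Db A) (i : ℕ) :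
    level (DMod A) M i ⊆ Db A :=
  level_subset hM (fun _ => mem_Db_of_isZero) (fun _ _ => mem_Db_of_isRetract)
    (fun _ => mem_Db_shift) mem_Db_of_distTriang i

end DbClosure


section Semisimple

variable {A}

/-- The Jacobson radical of `A` annihilates the `A`-module `V`. -/
def JKills (V : Type) [AddCommGroup V] [Module A V] : Prop :=
  ∀ a ∈ Ring.jacobson A, ∀ x : V, a • x = 0

lemma JKills.of_injective {V W : Type} [AddCommGroup V] [Module A V] [AddCommGroup W] [Module A W]
    (h : JKills (A := A) W) (f : V →ₗ[A] W) (hf : Function.Injective f) : JKills (A := A) V :=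
  fun a ha x => hf (by rw [map_smul, h a ha, map_zero])

lemma JKills.of_surjective {V W : Type} [AddCommGroup V] [Module A V] [AddCommGroup W]
    [Module A W] (h : JKills (A := A) V) (f : V →ₗ[A] W) (hf : Function.Surjective f) :
    JKills (A := A) W := fun a ha x => by
  obtain ⟨y, rfl⟩ := hf x
  rw [← map_smul, h a ha, map_zero]

lemma JKills.isSemisimpleModule [IsArtinianRing A] {V : Type} [AddCommGroup V] [Module A V]
    (h : JKills (A := A) V) : IsSemisimpleModule A V := by
  have hM : Module.IsTorsionBySet A V (Ring.jacobson A : Set A) := fun x a => h a a.2 x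
  let _ := hM.module
  exact hM.isSemisimpleModule_iff.mp inferInstance

lemma jkills_quotient : JKills (A := A) (A ⧸ Ring.jacobson A) := fun a ha x => by
  obtain ⟨y, rfl⟩ := Submodule.Quotient.mk_surjective _ x
  rw [← Submodule.Quotient.mk_smul, Submodule.Quotient.mk_eq_zero, smul_eq_mul]
  exact Ideal.IsTwoSided.mul_mem_of_left y ha

/-- A finitely generated module killed by the Jacobson radical of an artinian ring is a direct
summand of a finite power of the ring modulo its radical. -/
lemma JKills.exists_retract [IsArtinianRing A] {V : Type} [AddCommGroup V] [Module A V]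
    [Module.Finite A V] (h : JKills (A := A) V) :
    ∃ (m : ℕ) (s : V →ₗ[A] (Fin m → A ⧸ Ring.jacobson A))
      (r : (Fin m → A ⧸ Ring.jacobson A) →ₗ[A] V), r ∘ₗ s = LinearMap.id := by
  obtain ⟨m, v, hv⟩ := Module.Finite.exists_fin (R := A) (M := V)
  have := (jkills_quotient (A := A)).isSemisimpleModule
  let r : (Fin m → A ⧸ Ring.jacobson A) →ₗ[A] V :=
    LinearMap.lsum A (fun _ => A ⧸ Ring.jacobson A) ℕ fun i =>
      (Ring.jacobson A).liftQ (LinearMap.toSpanSingleton A V (v i)) fun a ha => h a ha _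
  have hr : Function.Surjective r := by
    rw [← LinearMap.range_eq_top, ← top_le_iff, ← hv, Submodule.span_le]
    rintro _ ⟨i, rfl⟩
    refine ⟨Pi.single i (Submodule.Quotient.mk 1), ?_⟩
    simp only [r]
    rw [LinearMap.lsum_apply, LinearMap.sum_apply, Finset.sum_eq_single i]
    · simp only [LinearMap.comp_apply, LinearMap.proj_apply, Pi.single_eq_same]
      exact one_smul A (v i)
    · intro j _ hj
      simp [Pi.single_eq_of_ne hj]
    · simp
  obtain ⟨s, hs⟩ := IsSemisimpleModule.lifting_property r hr LinearMap.id
  exact ⟨m, s, r, hs⟩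

variable (A) in
/-- The quotient of `A` by its Jacobson radical, as an object of the derived category. -/
noncomputable abbrev radQuotient : DMod A :=
  (DerivedCategory.singleFunctor (ModuleCat.{0} A) 0).obj (.of A (A ⧸ Ring.jacobson A))

lemma gen_functor_pi {C : Type*} [Category C] [HasZeroObject C] [Preadditive C] [HasShift C ℤ]
    [∀ n : ℤ, (shiftFunctor C n).Additive] [Pretriangulated C]
    (F : ModuleCat.{0} A ⥤ C) [F.Additive] (V : Type) [AddCommGroup V] [Module A V] (m : ℕ) :
    gen C (F.obj (.of A V)) (F.obj (.of A (Fin m → V))) := by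
  induction m with
  | zero =>
    exact gen_of_isZero _ (F.map_isZero (ModuleCat.isZero_of_subsingleton _))
  | succ m ih =>
    let e := Fin.consLinearEquiv A (fun _ : Fin (m + 1) => V)
    refine gen.sum (F.map (ModuleCat.ofHom (e.toLinearMap ∘ₗ LinearMap.inl A _ _)))
      (F.map (ModuleCat.ofHom (LinearMap.fst A _ _ ∘ₗ e.symm.toLinearMap)))
      (F.map (ModuleCat.ofHom (e.toLinearMap ∘ₗ LinearMap.inr A _ _)))
      (F.map (ModuleCat.ofHom (LinearMap.snd A _ _ ∘ₗ e.symm.toLinearMap)))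
      gen.base ih ?_ ?_ ?_ ?_ ?_
    all_goals
      simp only [← F.map_comp, ← F.map_add, ← ModuleCat.ofHom_comp, ← F.map_id, ← F.map_zero]
      congr 1
    refine ModuleCat.hom_ext (LinearMap.ext fun x => ?_)
    change e ((e.symm x).1, 0) + e (0, (e.symm x).2) = x
    rw [← map_add, Prod.mk_add_mk, add_zero, zero_add, Prod.mk.eta, e.apply_symm_apply]

lemma gen_single [IsArtinianRing A] {V : ModuleCat.{0} A} [Module.Finite A V]
    (h : JKills (A := A) V) (n : ℤ) :
    gen (DMod A) (radQuotient A)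
      ((DerivedCategory.singleFunctor (ModuleCat.{0} A) n).obj V) := by
  obtain ⟨m, s, r, hs⟩ := h.exists_retract
  have h₀ : gen (DMod A) (radQuotient A)
      ((DerivedCategory.singleFunctor (ModuleCat.{0} A) 0).obj V) := by
    refine (gen_functor_pi (DerivedCategory.singleFunctor (ModuleCat.{0} A) 0) _ m).retract
      ⟨(DerivedCategory.singleFunctor _ 0).map (ModuleCat.ofHom s),
        (DerivedCategory.singleFunctor _ 0).map (ModuleCat.ofHom r), ?_⟩
    rw [← Functor.map_comp, ← ModuleCat.ofHom_comp, hs, ModuleCat.ofHom_id]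
    exact CategoryTheory.Functor.map_id _ _
  exact gen_of_iso (((DerivedCategory.singleFunctors (ModuleCat.{0} A)).shiftIso (-n) n 0
    (by lia)).app V).symm (h₀.shift (-n))

end Semisimple
section Complexes

open HomologicalComplex ZeroObject

variable {A}

lemma isZero_of_homology {X : DMod A} (h : ∀ n, IsZero ((homol A n).obj X)) : IsZero X := by
  have : IsIso (0 : X ⟶ 0) := by
    rw [DerivedCategory.isIso_iff]
    exact fun n => ⟨0, (h n).eq_of_src _ _, ((homol A n).map_isZero (isZero_zero _)).eq_of_src _ _⟩
  exact (isZero_zero (DMod A)).of_iso (asIso (0 : X ⟶ 0))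

lemma isZero_Q_of_homology {L : CochainComplex (ModuleCat.{0} A) ℤ}
    (h : ∀ n, IsZero (L.homology n)) : IsZero (DerivedCategory.Q.obj L) :=
  isZero_of_homology fun n => (h n).of_iso ((DerivedCategory.homologyFunctorFactors _ n).app L)

lemma exists_retraction {X Y : ModuleCat.{0} A} [IsSemisimpleModule A Y] (f : X ⟶ Y) [Mono f] :
    ∃ r : Y ⟶ X, f ≫ r = 𝟙 X := by
  obtain ⟨r, hr⟩ := IsSemisimpleModule.extension_property f.hom
    ((ModuleCat.mono_iff_injective f).mp inferInstance) LinearMap.id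
  exact ⟨ModuleCat.ofHom r, ModuleCat.hom_ext hr⟩

lemma exists_section {X Y : ModuleCat.{0} A} [IsSemisimpleModule A X] (f : X ⟶ Y) [Epi f] :
    ∃ s : Y ⟶ X, s ≫ f = 𝟙 Y := by
  obtain ⟨s, hs⟩ := IsSemisimpleModule.lifting_property f.hom
    ((ModuleCat.epi_iff_surjective f).mp inferInstance) LinearMap.id
  exact ⟨ModuleCat.ofHom s, ModuleCat.hom_ext hs⟩

lemma JKills.of_mono {X Y : ModuleCat.{0} A} (h : JKills (A := A) Y) (f : X ⟶ Y) [Mono f] :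
    JKills (A := A) X :=
  h.of_injective f.hom ((ModuleCat.mono_iff_injective f).mp inferInstance)

lemma JKills.of_epi {X Y : ModuleCat.{0} A} (h : JKills (A := A) X) (f : X ⟶ Y) [Epi f] :
    JKills (A := A) Y :=
  h.of_surjective f.hom ((ModuleCat.epi_iff_surjective f).mp inferInstance)

lemma jkills_homology {L : CochainComplex (ModuleCat.{0} A) ℤ} {n : ℤ}
    (hJ : JKills (A := A) (L.X n)) : JKills (A := A) (L.homology n) :=
  (hJ.of_mono (L.iCycles n)).of_epi (L.homologyπ n)

/-- A complex of semisimple modules has its homology as a direct summand. -/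
lemma exists_single_retract [IsArtinianRing A] {L : CochainComplex (ModuleCat.{0} A) ℤ} {n : ℤ}
    (hJ : JKills (A := A) (L.X n)) :
    ∃ (i : (single _ _ n).obj (L.homology n) ⟶ L) (p : L ⟶ (single _ _ n).obj (L.homology n)),
      i ≫ p = 𝟙 _ := by
  have := hJ.isSemisimpleModule
  have := (hJ.of_mono (L.iCycles n)).isSemisimpleModule
  obtain ⟨r, hr⟩ := exists_retraction (L.iCycles n)
  obtain ⟨s, hs⟩ := exists_section (L.homologyπ n)
  refine ⟨mkHomFromSingle (s ≫ L.iCycles n) fun k _ => by simp,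
    mkHomToSingle (r ≫ L.homologyπ n) fun k _ => ?_, ?_⟩
  · rw [← L.toCycles_i k n, Category.assoc, reassoc_of% hr, toCycles_comp_homologyπ]
  · apply from_single_hom_ext
    simp [reassoc_of% hr, reassoc_of% hs]

/-- The derived category class of a complex of semisimple modules with bounded finitely
generated homology is a finite sum of shifts of summands of the ring modulo its radical. -/
lemma gen_of_jkills [IsArtinianRing A] (S : Finset ℤ) :
    ∀ (L : CochainComplex (ModuleCat.{0} A) ℤ), (∀ n, JKills (A := A) (L.X n)) →
      (∀ n, Module.Finite A (L.homology n)) → (∀ n ∉ S, IsZero (L.homology n)) →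
      gen (DMod A) (radQuotient A) (DerivedCategory.Q.obj L) := by
  induction S using Finset.induction_on with
  | empty =>
    intro L _ _ hS
    exact gen_of_isZero _ (isZero_Q_of_homology fun n => hS n (by simp))
  | insert n S _ ih =>
    intro L hJ hfin hS
    obtain ⟨i, p, hip⟩ := exists_single_retract (hJ n)
    let j := kernel.ι p
    let q : L ⟶ kernel p := kernel.lift p (𝟙 L - p ≫ i) (by simp [hip])
    have hqj : q ≫ j = 𝟙 L - p ≫ i := kernel.lift_ι _ _ _
    have hjp : j ≫ p = 0 := kernel.condition p
    have hjq : j ≫ q = 𝟙 _ := by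
      rw [← cancel_mono j, Category.assoc, hqj]
      simp [reassoc_of% hjp]
    have hiq : i ≫ q = 0 := by
      rw [← cancel_mono j, Category.assoc, hqj]
      simp [reassoc_of% hip]
    have hH : ∀ k, homologyMap j k ≫ homologyMap q k = 𝟙 _ := fun k => by
      rw [← homologyMap_comp, hjq, homologyMap_id]
    have := hfin n
    have hn : homologyMap j n = 0 := by
      let g := homologyMap p n ≫ (singleObjHomologySelfIso _ n (L.homology n)).hom
      have : IsSplitEpi (homologyMap p n) := ⟨⟨homologyMap i n, by
        rw [← homologyMap_comp, hip, homologyMap_id]⟩⟩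
      have hg : Function.Surjective g.hom := (ModuleCat.epi_iff_surjective g).mp inferInstance
      have : Mono g := (ModuleCat.mono_iff_injective g).mpr
        (IsNoetherian.injective_of_surjective_endomorphism g.hom hg)
      rw [← cancel_mono g, ← Category.assoc, ← homologyMap_comp, hjp]
      simp
    have hL' := ih (kernel p) (fun k => (hJ k).of_mono (j.f k))
      (fun k => have := hfin k; finite_of_retract _ _ (hH k)) fun k hk => by
        by_cases h : k = n
        · subst h
          rw [IsZero.iff_id_eq_zero, ← hH, hn, zero_comp]
        · exact isZero_of_retract _ _ (hH k) (hS k (by simp [h, hk]))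
    let F := DerivedCategory.Q (C := ModuleCat.{0} A)
    refine gen.sum (F.map i) (F.map p) (F.map j) (F.map q)
      (gen_single (jkills_homology (hJ n)) n) hL' ?_ ?_ ?_ ?_ ?_
    · rw [← F.map_comp, hip]; exact F.map_id _
    · rw [← F.map_comp, hjq, F.map_id]
    · rw [← F.map_comp, hiq, F.map_zero]
    · rw [← F.map_comp, hjp, F.map_zero]
    · rw [← F.map_comp, ← F.map_comp, ← F.map_add, hqj, add_sub_cancel, F.map_id]
/-- The subcomplex given by a family of submodules stable under the differential. -/
noncomputable def subcomplex (K : CochainComplex (ModuleCat.{0} A) ℤ)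
    (N : ∀ n, Submodule A (K.X n)) (hN : ∀ i j, N i ≤ (N j).comap (K.d i j).hom) :
    CochainComplex (ModuleCat.{0} A) ℤ where
  X n := .of A (N n)
  d i j := ModuleCat.ofHom ((K.d i j).hom.restrict (hN i j))
  shape i j h := by
    ext x
    change (K.d i j).hom x.1 = 0
    rw [K.shape i j h]
    rfl
  d_comp_d' i j k _ _ := by
    ext x
    change (K.d i j ≫ K.d j k).hom x.1 = 0
    rw [K.d_comp_d]
    rfl

section Subcomplex

variable (K : CochainComplex (ModuleCat.{0} A) ℤ)
    (N : ∀ n, Submodule A (K.X n)) (hN : ∀ i j, N i ≤ (N j).comap (K.d i j).hom)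

/-- The inclusion of a subcomplex. -/
noncomputable def subcomplexι : subcomplex K N hN ⟶ K where
  f n := ModuleCat.ofHom (N n).subtype
  comm' _ _ _ := rfl

instance : Mono (subcomplexι K N hN) :=
  have : ∀ n, Mono ((subcomplexι K N hN).f n) := fun n =>
    (ModuleCat.mono_iff_injective _).mpr (N n).subtype_injective
  HomologicalComplex.mono_of_mono_f _ this

/-- The short exact sequence of complexes given by a subcomplex. -/
noncomputable abbrev subcomplexSES : ShortComplex (CochainComplex (ModuleCat.{0} A) ℤ) :=
  .mk (subcomplexι K N hN) (cokernel.π (subcomplexι K N hN)) (cokernel.condition _)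

lemma subcomplexSES_shortExact : (subcomplexSES K N hN).ShortExact where
  exact := ShortComplex.exact_cokernel _

lemma cokernel_subcomplexι_surjective (n : ℤ) :
    Function.Surjective ((cokernel.π (subcomplexι K N hN)).f n).hom :=
  (ModuleCat.epi_iff_surjective _).mp inferInstance

lemma cokernel_subcomplexι_eq_zero_iff {n : ℤ} (x : K.X n) :
    (cokernel.π (subcomplexι K N hN)).f n x = 0 ↔ x ∈ N n := by
  have h := ((subcomplexSES_shortExact K N hN).map_of_exact (eval _ _ n)).exact
  rw [ShortComplex.moduleCat_exact_iff] at h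
  constructor
  · intro hx
    obtain ⟨y, rfl⟩ := h x hx
    exact y.2
  · intro hx
    change ((subcomplexι K N hN ≫ cokernel.π (subcomplexι K N hN)).f n).hom ⟨x, hx⟩ = 0
    rw [cokernel.condition]
    rfl

end Subcomplex

/-- The derived category class of a bounded complex of finitely generated modules annihilated by
the `d`-th power of the radical is built in `d` steps from the ring modulo its radical. -/
lemma mem_level_of_forall_list [IsArtinianRing A] (d : ℕ) :
    ∀ (L : CochainComplex (ModuleCat.{0} A) ℤ) (a b : ℤ), (∀ n, n < a ∨ b < n → IsZero (L.X n)) →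
      (∀ n, Module.Finite A (L.X n)) →
      (∀ l : List A, l.length = d → (∀ a ∈ l, a ∈ Ring.jacobson A) →
        ∀ (n : ℤ) (x : L.X n), l.prod • x = 0) →
      DerivedCategory.Q.obj L ∈ level (DMod A) (radQuotient A) d := by
  induction d with
  | zero =>
    intro L _ _ _ _ hL
    have h : ∀ n, Subsingleton (L.X n) := fun n =>
      subsingleton_of_forall_eq 0 fun x => by simpa using hL [] rfl (by simp) n x
    exact isZero_Q_of_homology fun n =>
      (HomologicalComplex.ExactAt.of_isZero (ModuleCat.isZero_of_subsingleton _)).isZero_homology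
  | succ d ih =>
    intro L a b hab hfin hL
    let N : ∀ n, Submodule A (L.X n) := fun n => Ring.jacobson A • ⊤
    have hN : ∀ i j, N i ≤ (N j).comap (L.d i j).hom := fun i j =>
      Submodule.smul_le.mpr fun r hr x _ => by
        rw [Submodule.mem_comap, map_smul]
        exact Submodule.smul_mem_smul hr trivial
    have hsub : DerivedCategory.Q.obj (subcomplex L N hN) ∈ level (DMod A) (radQuotient A) d := by
      refine ih _ a b (fun n hn => ?_) (fun n => ?_) fun l hl hlJ n x => ?_
      · have := ModuleCat.subsingleton_of_isZero (hab n hn)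
        exact ModuleCat.isZero_of_subsingleton (ModuleCat.of A (N n))
      · have := hfin n
        exact inferInstanceAs (Module.Finite A (N n))
      · refine Subtype.ext ?_
        change l.prod • x.1 = 0
        obtain ⟨x, hx⟩ := x
        change l.prod • x = 0
        refine Submodule.smul_induction_on hx (fun r hr y _ => ?_) fun y z hy hz => ?_
        · have := hL (l ++ [r]) (by simp [hl]) (by simpa [or_imp, forall_and] using ⟨hlJ, hr⟩) n y
          simpa [mul_smul] using this
        · rw [smul_add, hy, hz, add_zero]
    let R := cokernel (subcomplexι L N hN)
    have hπ := cokernel_subcomplexι_surjective L N hN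
    have hquot : gen (DMod A) (radQuotient A) (DerivedCategory.Q.obj R) := by
      have hRfin : ∀ n, Module.Finite A (R.X n) := fun n =>
        have := hfin n
        Module.Finite.of_surjective _ (hπ n)
      refine gen_of_jkills (Finset.Icc a b) R (fun n r hr x => ?_) (fun n => ?_) fun n hn => ?_
      · obtain ⟨y, rfl⟩ := hπ n x
        rw [← map_smul]
        exact (cokernel_subcomplexι_eq_zero_iff L N hN _).mpr
          (Submodule.smul_mem_smul hr trivial)
      · have := hRfin n
        have : Module.Finite A (R.cycles n) := Module.Finite.of_injective (R.iCycles n).hom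
          ((ModuleCat.mono_iff_injective _).mp inferInstance)
        exact Module.Finite.of_surjective (R.homologyπ n).hom
          ((ModuleCat.epi_iff_surjective _).mp inferInstance)
      · have := ModuleCat.subsingleton_of_isZero (hab n (by rw [Finset.mem_Icc] at hn; lia))
        have := (hπ n).subsingleton
        exact (HomologicalComplex.ExactAt.of_isZero
          (ModuleCat.isZero_of_subsingleton (R.X n))).isZero_homology
    exact mem_level_succ
      (DerivedCategory.triangleOfSES_distinguished (subcomplexSES_shortExact L N hN)) hsub hquot
lemma exists_fg_map_eq {V W : Type} [AddCommGroup V] [Module A V] [AddCommGroup W] [Module A W]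
    (f : V →ₗ[A] W) (U : Submodule A V) (h : (U.map f).FG) :
    ∃ P ≤ U, P.FG ∧ P.map f = U.map f := by
  classical
  obtain ⟨s, hs⟩ := h
  have hsub : (s : Set W) ⊆ f '' U := by
    rw [← Submodule.map_coe, ← hs]
    exact Submodule.subset_span
  obtain ⟨t, htU, rfl⟩ := Finset.subset_set_image_iff.mp hsub
  exact ⟨.span A t, Submodule.span_le.mpr htU, ⟨t, rfl⟩, by
    rw [Submodule.map_span, ← hs, Finset.coe_image]⟩

/-- The conditions on a family of submodules of a complex, in degree `n`, for it to define
a quasi-isomorphic subcomplex of finitely generated modules. -/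
structure IsFGModelAt (K : CochainComplex (ModuleCat.{0} A) ℤ) (N : ∀ n, Submodule A (K.X n))
    (n : ℤ) : Prop where
  fg : (N n).FG
  le : N n ≤ (N (n + 1)).comap (K.d n (n + 1)).hom
  exists_sub_mem : ∀ x, K.d n (n + 1) x ∈ N (n + 1) → ∃ y, x - K.d (n - 1) n y ∈ N n

lemma IsFGModelAt.of_isZero {K : CochainComplex (ModuleCat.{0} A) ℤ}
    (N : ∀ n, Submodule A (K.X n)) {n : ℤ} (h : IsZero (K.X n)) : IsFGModelAt K N n := by
  have := ModuleCat.subsingleton_of_isZero h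
  refine ⟨?_, fun x _ => ?_, fun x _ => ⟨0, ?_⟩⟩
  · rw [Subsingleton.elim (N n) ⊥]
    exact Submodule.fg_bot
  · rw [Subsingleton.elim x 0]
    exact Submodule.zero_mem _
  · rw [Subsingleton.elim (x - _) 0]
    exact Submodule.zero_mem _

lemma exists_fg_cycles (K : CochainComplex (ModuleCat.{0} A) ℤ) (n : ℤ)
    [Module.Finite A (K.homology n)] :
    ∃ P : Submodule A (K.X n), P.FG ∧ (∀ x ∈ P, K.d n (n + 1) x = 0) ∧
      ∀ x, K.d n (n + 1) x = 0 → ∃ y, x - K.d (n - 1) n y ∈ P := by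
  let S := K.sc' (n - 1) n (n + 1)
  let e : K.homology n ≅ S.moduleCatLeftHomologyData.H :=
    K.homologyIsoSc' (n - 1) n (n + 1) (by simp) (by simp) ≪≫ S.moduleCatHomologyIso
  have hfin : Module.Finite A (LinearMap.ker S.g.hom ⧸ LinearMap.range S.moduleCatToCycles) :=
    finite_of_retract _ _ e.inv_hom_id
  obtain ⟨P, -, hP, hPtop⟩ := exists_fg_map_eq (LinearMap.range S.moduleCatToCycles).mkQ ⊤
    (by rw [Submodule.map_top, Submodule.range_mkQ]; exact hfin.fg_top)
  refine ⟨P.map (LinearMap.ker S.g.hom).subtype, hP.map _, ?_, fun x hx => ?_⟩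
  · rintro _ ⟨x, -, rfl⟩
    exact x.2
  · have hx' : (LinearMap.range S.moduleCatToCycles).mkQ ⟨x, hx⟩ ∈
        P.map (LinearMap.range S.moduleCatToCycles).mkQ := by
      rw [hPtop]
      exact ⟨_, trivial, rfl⟩
    obtain ⟨p, hp, hpx⟩ := hx'
    rw [Submodule.mkQ_apply, Submodule.mkQ_apply, eq_comm, Submodule.Quotient.eq] at hpx
    obtain ⟨y, hy⟩ := hpx
    refine ⟨y, p, hp, ?_⟩
    have : K.d (n - 1) n y = x - (show K.X n from p.1) := congrArg Subtype.val hy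
    rw [this, sub_sub_cancel]
    rfl

lemma exists_isFGModelAt_step [IsNoetherianRing A] (K : CochainComplex (ModuleCat.{0} A) ℤ)
    (n : ℤ) [Module.Finite A (K.homology n)] (W : Submodule A (K.X (n + 1))) (hW : W.FG) :
    ∃ P : Submodule A (K.X n), P.FG ∧ P ≤ W.comap (K.d n (n + 1)).hom ∧
      ∀ x, K.d n (n + 1) x ∈ W → ∃ y, x - K.d (n - 1) n y ∈ P := by
  obtain ⟨P, hP, hP0, hPy⟩ := exists_fg_cycles K n
  obtain ⟨P', hP'W, hP', hmap⟩ := exists_fg_map_eq (K.d n (n + 1)).hom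
    (W.comap (K.d n (n + 1)).hom) (hW.of_le (Submodule.map_comap_le _ _))
  refine ⟨P ⊔ P', hP.sup hP', sup_le (fun x hx => ?_) hP'W, fun x hx => ?_⟩
  · rw [Submodule.mem_comap]
    change K.d n (n + 1) x ∈ W
    rw [hP0 x hx]
    exact W.zero_mem
  · have : (K.d n (n + 1)).hom x ∈ P'.map (K.d n (n + 1)).hom := by
      rw [hmap]
      exact ⟨x, hx, rfl⟩
    obtain ⟨p', hp', hpx⟩ := this
    obtain ⟨y, hy⟩ := hPy (x - p') (by rw [map_sub]; exact sub_eq_zero.mpr hpx.symm)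
    refine ⟨y, ?_⟩
    rw [show x - K.d (n - 1) n y = (x - p' - K.d (n - 1) n y) + p' by abel]
    exact Submodule.add_mem_sup hy hp'

lemma exists_isFGModelAt [IsNoetherianRing A] (K : CochainComplex (ModuleCat.{0} A) ℤ) (b : ℤ)
    (hb : ∀ n, b < n → IsZero (K.X n)) (hfin : ∀ n, Module.Finite A (K.homology n)) (m : ℕ) :
    ∃ N : ∀ n, Submodule A (K.X n), ∀ n, b - m < n → IsFGModelAt K N n := by
  induction m with
  | zero => exact ⟨fun _ => ⊥, fun n hn => .of_isZero _ (hb n (by simpa using hn))⟩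
  | succ m ih =>
    obtain ⟨N, hN⟩ := ih
    have hfg : (N (b - m + 1)).FG := (hN _ (by lia)).fg
    have := hfin (b - m)
    obtain ⟨P, hP⟩ := exists_isFGModelAt_step K (b - m) _ hfg
    refine ⟨Function.update N (b - m) P, fun n hn => ?_⟩
    have hne : n + 1 ≠ b - m := by push_cast at hn; lia
    by_cases h : n = b - m
    · subst h
      refine ⟨?_, ?_, ?_⟩ <;> rw [Function.update_self]
      exacts [hP.1, by rw [Function.update_of_ne hne]; exact hP.2.1,
        by rw [Function.update_of_ne hne]; exact hP.2.2]
    · obtain ⟨h₁, h₂, h₃⟩ := hN n (by push_cast at hn; lia)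
      refine ⟨?_, ?_, ?_⟩ <;> rw [Function.update_of_ne h]
      exacts [h₁, by rw [Function.update_of_ne hne]; exact h₂,
        by rw [Function.update_of_ne hne]; exact h₃]

/-- A bounded complex with finitely generated homology over a noetherian ring is
quasi-isomorphic to a bounded complex of finitely generated modules. -/
lemma exists_finite_model [IsNoetherianRing A] (K : CochainComplex (ModuleCat.{0} A) ℤ) (a b : ℤ)
    (hab : ∀ n, n < a ∨ b < n → IsZero (K.X n)) (hfin : ∀ n, Module.Finite A (K.homology n)) :
    ∃ L : CochainComplex (ModuleCat.{0} A) ℤ, (∀ n, n < a ∨ b < n → IsZero (L.X n)) ∧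
      (∀ n, Module.Finite A (L.X n)) ∧
      Nonempty (DerivedCategory.Q.obj L ≅ DerivedCategory.Q.obj K) := by
  obtain ⟨N, hN⟩ : ∃ N : ∀ n, Submodule A (K.X n), ∀ n, IsFGModelAt K N n := by
    obtain ⟨N, hN⟩ := exists_isFGModelAt K b (fun n hn => hab n (.inr hn)) hfin (b - a + 1).toNat
    refine ⟨N, fun n => ?_⟩
    by_cases h : b - (b - a + 1).toNat < n
    · exact hN n h
    · exact .of_isZero _ (hab n (by lia))
  have hNd : ∀ i j, N i ≤ (N j).comap (K.d i j).hom := fun i j => by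
    by_cases h : i + 1 = j
    · subst h
      exact (hN i).le
    · rw [K.shape i j h]
      exact fun _ _ => Submodule.zero_mem _
  refine ⟨subcomplex K N hNd, fun n hn => ?_, fun n => ?_, ?_⟩
  · have := ModuleCat.subsingleton_of_isZero (hab n hn)
    exact ModuleCat.isZero_of_subsingleton (ModuleCat.of A (N n))
  · exact Module.Finite.iff_fg.mpr (hN n).fg
  · have hT := DerivedCategory.triangleOfSES_distinguished (subcomplexSES_shortExact K N hNd)
    have hzero : IsZero (DerivedCategory.Q.obj (cokernel (subcomplexι K N hNd))) := by
      let π := cokernel.π (subcomplexι K N hNd)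
      refine isZero_Q_of_homology fun n => ?_
      rw [← exactAt_iff_isZero_homology, exactAt_iff' _ (n - 1) n (n + 1) (by simp) (by simp),
        ShortComplex.moduleCat_exact_iff]
      intro x hx
      obtain ⟨x, rfl⟩ := cokernel_subcomplexι_surjective K N hNd n x
      have hdx : K.d n (n + 1) x ∈ N (n + 1) := by
        rw [← cokernel_subcomplexι_eq_zero_iff K N hNd, ← ModuleCat.comp_apply, ← π.comm]
        exact hx
      obtain ⟨y, hy⟩ := (hN n).exists_sub_mem x hdx
      rw [← cokernel_subcomplexι_eq_zero_iff K N hNd, map_sub, sub_eq_zero,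
        ← ModuleCat.comp_apply, ← π.comm] at hy
      exact ⟨π.f (n - 1) y, hy.symm⟩
    have : IsIso (DerivedCategory.Q.map (subcomplexι K N hNd)) :=
      (Triangle.isZero₃_iff_isIso₁ _ hT).mp hzero
    exact ⟨asIso (DerivedCategory.Q.map (subcomplexι K N hNd))⟩

lemma exists_finite_model_of_mem_Db [IsNoetherianRing A] {X : DMod A} (hX : X ∈ Db A) :
    ∃ (L : CochainComplex (ModuleCat.{0} A) ℤ) (a b : ℤ),
      (∀ n, n < a ∨ b < n → IsZero (L.X n)) ∧ (∀ n, Module.Finite A (L.X n)) ∧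
      Nonempty (X ≅ DerivedCategory.Q.obj L) := by
  obtain ⟨⟨a, b, hab⟩, hfin⟩ := hX
  have : X.IsGE a := (X.isGE_iff a).mpr fun n hn => hab n (.inl hn)
  have : X.IsLE b := (X.isLE_iff b).mpr fun n hn => hab n (.inr hn)
  obtain ⟨K, _, _, ⟨e⟩⟩ := X.exists_iso_Q_obj_of_isGE_of_isLE a b
  have hK : ∀ n, Module.Finite A (K.homology n) := fun n =>
    have := hfin n
    let e' := (homol A n).mapIso e ≪≫ (DerivedCategory.homologyFunctorFactors _ n).app K
    finite_of_retract _ _ e'.inv_hom_id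
  obtain ⟨L, hL, hLfin, ⟨e'⟩⟩ := exists_finite_model K a b (fun n hn => hn.elim
    (fun h => K.isZero_of_isStrictlyGE a n h) (fun h => K.isZero_of_isStrictlyLE b n h)) hK
  exact ⟨L, a, b, hL, hLfin, ⟨e ≪≫ e'.symm⟩⟩

end Complexes

section Final

variable {A}

lemma radQuotient_mem_Db [IsNoetherianRing A] : radQuotient A ∈ Db A := by
  let V := ModuleCat.of A (A ⧸ Ring.jacobson A)
  have e : ∀ n, (homol A n).obj (radQuotient A) ≅
      ((HomologicalComplex.single _ (ComplexShape.up ℤ) 0).obj V).homology n := fun n =>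
    (DerivedCategory.homologyFunctorFactors _ n).app _
  have hne : ∀ n ≠ 0, IsZero ((homol A n).obj (radQuotient A)) := fun n hn =>
    (HomologicalComplex.exactAt_single_obj _ 0 V n hn).isZero_homology.of_iso (e n)
  refine ⟨⟨0, 0, fun n hn => hne n (by lia)⟩, fun n => ?_⟩
  by_cases hn : n = 0
  · subst hn
    let e' := e 0 ≪≫ HomologicalComplex.singleObjHomologySelfIso _ 0 V
    have : Module.Finite A V := inferInstanceAs (Module.Finite A (A ⧸ Ring.jacobson A))
    exact finite_of_retract _ _ e'.hom_inv_id
  · have := ModuleCat.subsingleton_of_isZero (hne n hn)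
    infer_instance

lemma level_radQuotient_eq_Db [IsArtinianRing A] {d : ℕ}
    (hd : ∀ l : List A, l.length = d → (∀ x ∈ l, x ∈ Ring.jacobson A) → l.prod = 0) :
    level (DMod A) (radQuotient A) d = Db A := by
  refine (level_subset_Db radQuotient_mem_Db d).antisymm fun X hX => ?_
  obtain ⟨L, a, b, hab, hfin, ⟨e⟩⟩ := exists_finite_model_of_mem_Db hX
  exact level_of_iso e (mem_level_of_forall_list d L a b hab hfin
    fun l hl hlJ n x => by rw [hd l hl hlJ, zero_smul])

lemma prod_mem_pow (I : Ideal A) [I.IsTwoSided] (l : List A) (hl : ∀ x ∈ l, x ∈ I) :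
    l.prod ∈ I ^ l.length := by
  induction l with
  | nil =>
    rw [List.length_nil, Submodule.pow_zero, Ideal.one_eq_top]
    trivial
  | cons x l ih =>
    rw [List.prod_cons, List.length_cons, Ideal.IsTwoSided.pow_succ]
    exact Ideal.mul_mem_mul (hl x (by simp)) (ih fun y hy => hl y (by simp [hy]))

end Final

end RouquierLoewy

open RouquierLoewy in
/-- **Rouquier**: for a finite dimensional algebra `A` over a field `k`, the dimension of
the bounded derived category `D^b(mod A)` is strictly smaller than the Loewy length
of `A`. -/
theorem dim_Db_lt_loewyLength (k : Type) [Field k]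
    (A : Type) [Ring A] [Algebra k A] [FiniteDimensional k A] :
    trdim _ (Db A) < loewyLength A := by
  have : IsArtinianRing A := IsArtinianRing.of_finite k A
  let S : Set ℕ := {d : ℕ | 1 ≤ d ∧ ∀ l : List A, l.length = d →
    (∀ x ∈ l, x ∈ (⊥ : Ideal A).jacobson) → l.prod = 0}
  have hS : S.Nonempty := by
    obtain ⟨n, hn⟩ := IsArtinianRing.isNilpotent_jacobson_bot (R := A)
    refine ⟨n + 1, by lia, fun l hl hlJ => ?_⟩
    have := prod_mem_pow _ l hlJ
    rw [hl, Submodule.pow_succ, hn, zero_mul] at this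
    exact this
  obtain ⟨d, ⟨hd, hdJ⟩, hdL⟩ : loewyLength A ∈ ((↑) '' S : Set ℕ∞) := csInf_mem (hS.image _)
  rw [← hdL]
  obtain ⟨d, rfl⟩ := Nat.exists_eq_add_of_le' hd
  rw [Ideal.jacobson_bot] at hdJ
  have hle : trdim _ (Db A) ≤ (d : ℕ∞) :=
    sInf_le ⟨d, ⟨radQuotient A, radQuotient_mem_Db, level_radQuotient_eq_Db hdJ⟩, rfl⟩
  exact hle.trans_lt (by exact_mod_cast Nat.lt_succ_self d)
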